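/- arXiv:2307.05829 — 11 statements merged into one kernel-verified Lean document; each statement's English description precedes it below -/
import Mathlib

section
/- Let e* = e_p (for some 1 ≤ p ≤ n−1) be a single merged edge of weight B in a weighted path P_n with n ≥ 3, so that V_m = {v_p, v_{p+1}} and V̄_m = V ∖ V_m. Then every weight redistribution has error |ΔE| ≥ (n−2)·B = |V̄_m|·B. -/
/-- The weighted path `P_n` has vertices `1, …, n` and edges `e_i = (v_i, v_{i+1})`
with weight `w i`, for `1 ≤ i ≤ n-1`.  Given a set `M` of merged edges and a weight
redistribution `ε` (the new weight of a non-merged edge `e_i` is `w i + ε i`), the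
endpoints of merged edges form `V_m = M ∪ (M + 1)`, and the error between a pair of
vertices `u < v` is `|d_G(u,v) − d_{G′}(u,v)| = |Σ_{i∈[u,v)∩M} w i − Σ_{i∈[u,v)∖M} ε i|`,
since in the contracted path the distance between the images of `u` and `v` is the sum
of the new weights of the non-merged edges between them.  The total error `|ΔE|` sums this
over all unordered pairs of distinct vertices at least one of which lies outside `V_m`. -/
noncomputable def pathError (n : ℕ) (w : ℕ → ℝ) (M : Finset ℕ) (ε : ℕ → ℝ) : ℝ :=
  ∑ u ∈ Finset.Icc 1 n, ∑ v ∈ Finset.Icc 1 n,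
    if u < v ∧ (u ∉ (M ∪ M.image (· + 1)) ∨ v ∉ (M ∪ M.image (· + 1))) then
      |(∑ i ∈ (Finset.Ico u v).filter (· ∈ M), w i) -
        ∑ i ∈ (Finset.Ico u v).filter (· ∉ M), ε i|
    else 0

theorem filter_mem_singleton_Ico_of_notMem {a b p : ℕ} (h : p ∉ Finset.Ico a b) :
    (Finset.Ico a b).filter (· ∈ ({p} : Finset ℕ)) = ∅ := by
  ext i
  simp only [Finset.mem_filter, Finset.mem_singleton, Finset.notMem_empty, iff_false]
  rintro ⟨hi, rfl⟩
  exact h hi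

theorem filter_notMem_singleton_Ico_of_notMem {a b p : ℕ} (h : p ∉ Finset.Ico a b) :
    (Finset.Ico a b).filter (· ∉ ({p} : Finset ℕ)) = Finset.Ico a b := by
  refine Finset.filter_true_of_mem fun i hi => ?_
  rw [Finset.mem_singleton]
  rintro rfl
  exact h hi

theorem filter_mem_singleton_Ico_of_mem {a b p : ℕ} (h : p ∈ Finset.Ico a b) :
    (Finset.Ico a b).filter (· ∈ ({p} : Finset ℕ)) = {p} := by
  ext i
  simp only [Finset.mem_filter, Finset.mem_singleton, and_iff_right_iff_imp]
  rintro rfl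
  exact h

/-- For a nonnegative kernel, the mass of the pairs with exactly one coordinate in `T` is at most
the total mass. -/
theorem sum_cross_le_sum_of_nonneg {α : Type*} [DecidableEq α] {S T : Finset α} (hT : T ⊆ S)
    {F : α → α → ℝ} (hF : ∀ u v, 0 ≤ F u v) :
    (∑ u ∈ S \ T, ∑ v ∈ T, F u v) + ∑ u ∈ T, ∑ v ∈ S \ T, F u v ≤ ∑ u ∈ S, ∑ v ∈ S, F u v := by
  rw [← Finset.sum_sdiff hT (f := fun u => ∑ v ∈ S, F u v)]
  refine add_le_add (Finset.sum_le_sum fun u _ => ?_) (Finset.sum_le_sum fun u _ => ?_)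
  · exact Finset.sum_le_sum_of_subset_of_nonneg hT fun v _ _ => hF u v
  · exact Finset.sum_le_sum_of_subset_of_nonneg Finset.sdiff_subset fun v _ _ => hF u v

/-- Merging the single edge `e_p` (`1 ≤ p ≤ n−1`) of weight `B = w p` in a weighted path
`P_n` with `n ≥ 3`: every weight redistribution has error `|ΔE| ≥ (n−2)·B`. -/
theorem pathError_single_edge_lower_bound (n p : ℕ) (hn : 3 ≤ n)
    (hp1 : 1 ≤ p) (hp2 : p ≤ n - 1)
    (w : ℕ → ℝ) (hw : ∀ i, 0 ≤ w i) (ε : ℕ → ℝ)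
    (hε : ∀ i, 1 ≤ i → i ≤ n - 1 → i ≠ p → 0 ≤ w i + ε i) :
    ((n : ℝ) - 2) * w p ≤ pathError n w {p} ε := by
  unfold pathError
  set F : ℕ → ℕ → ℝ := fun u v =>
    if u < v ∧ (u ∉ (({p} : Finset ℕ) ∪ ({p} : Finset ℕ).image (· + 1)) ∨
        v ∉ (({p} : Finset ℕ) ∪ ({p} : Finset ℕ).image (· + 1))) then
      |(∑ i ∈ (Finset.Ico u v).filter (· ∈ ({p} : Finset ℕ)), w i) -
        ∑ i ∈ (Finset.Ico u v).filter (· ∉ ({p} : Finset ℕ)), ε i|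
    else 0 with hF
  have hF0 : ∀ u v, 0 ≤ F u v := by
    intro u v
    simp only [hF]
    split_ifs
    · exact abs_nonneg _
    · exact le_rfl
  have hT : ({p, p + 1} : Finset ℕ) ⊆ Finset.Icc 1 n := by
    intro x hx
    simp only [Finset.mem_insert, Finset.mem_singleton] at hx
    simp only [Finset.mem_Icc]
    omega
  have hbound : ∀ x ∈ Finset.Icc 1 n \ {p, p + 1},
      w p ≤ (F x p + F x (p + 1)) + (F p x + F (p + 1) x) := by
    intro x hx
    simp only [Finset.mem_sdiff, Finset.mem_insert, Finset.mem_singleton, not_or] at hx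
    obtain ⟨-, hxp, hxp1⟩ := hx
    have hxm : x ∉ (({p} : Finset ℕ) ∪ ({p} : Finset ℕ).image (· + 1)) := by
      simp [hxp, hxp1]
    rcases Nat.lt_or_gt_of_ne hxp with hlt | hgt
    · have h1 : F x p = |∑ i ∈ Finset.Ico x p, ε i| := by
        simp only [hF]
        rw [if_pos ⟨hlt, Or.inl hxm⟩, filter_mem_singleton_Ico_of_notMem (by simp),
          filter_notMem_singleton_Ico_of_notMem (by simp)]
        simp
      have h2 : F x (p + 1) = |w p - ∑ i ∈ Finset.Ico x p, ε i| := by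
        simp only [hF]
        rw [if_pos ⟨by omega, Or.inl hxm⟩, filter_mem_singleton_Ico_of_mem (by simp; omega)]
        rw [show (Finset.Ico x (p + 1)).filter (· ∉ ({p} : Finset ℕ)) = Finset.Ico x p by
          ext i; simp; omega]
        simp
      have := abs_add_le (∑ i ∈ Finset.Ico x p, ε i) (w p - ∑ i ∈ Finset.Ico x p, ε i)
      rw [add_sub_cancel] at this
      linarith [le_abs_self (w p), hF0 p x, hF0 (p + 1) x]
    · have h1 : F (p + 1) x = |∑ i ∈ Finset.Ico (p + 1) x, ε i| := by
        simp only [hF]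
        rw [if_pos ⟨by omega, Or.inr hxm⟩, filter_mem_singleton_Ico_of_notMem (by simp),
          filter_notMem_singleton_Ico_of_notMem (by simp)]
        simp
      have h2 : F p x = |w p - ∑ i ∈ Finset.Ico (p + 1) x, ε i| := by
        simp only [hF]
        rw [if_pos ⟨hgt, Or.inr hxm⟩, filter_mem_singleton_Ico_of_mem (by simp; omega)]
        rw [show (Finset.Ico p x).filter (· ∉ ({p} : Finset ℕ)) = Finset.Ico (p + 1) x by
          ext i; simp; omega]
        simp
      have := abs_add_le (∑ i ∈ Finset.Ico (p + 1) x, ε i)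
        (w p - ∑ i ∈ Finset.Ico (p + 1) x, ε i)
      rw [add_sub_cancel] at this
      linarith [le_abs_self (w p), hF0 x p, hF0 x (p + 1)]
  have hcard : ((Finset.Icc 1 n \ {p, p + 1}).card : ℝ) = (n : ℝ) - 2 := by
    rw [Finset.card_sdiff_of_subset hT, Finset.card_pair (by omega), Nat.card_Icc,
      Nat.add_sub_cancel, Nat.cast_sub (by omega)]
    norm_num
  calc ((n : ℝ) - 2) * w p = ∑ x ∈ Finset.Icc 1 n \ {p, p + 1}, w p := by
        rw [Finset.sum_const, nsmul_eq_mul, hcard]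
    _ ≤ ∑ x ∈ Finset.Icc 1 n \ {p, p + 1},
          ((F x p + F x (p + 1)) + (F p x + F (p + 1) x)) := Finset.sum_le_sum hbound
    _ = (∑ x ∈ Finset.Icc 1 n \ {p, p + 1}, ∑ y ∈ {p, p + 1}, F x y) +
          ∑ y ∈ {p, p + 1}, ∑ x ∈ Finset.Icc 1 n \ {p, p + 1}, F y x := by
        simp [Finset.sum_add_distrib]
    _ ≤ ∑ u ∈ Finset.Icc 1 n, ∑ v ∈ Finset.Icc 1 n, F u v :=
        sum_cross_le_sum_of_nonneg hT hF0
end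

section
/- Let e* = e_p (for some 1 ≤ p ≤ n−1) be a single merged edge of weight B in a weighted path P_n with n ≥ 3. If p ≥ 2 (e* has a left neighbouring edge), the redistribution that marks the left neighbour of e*, i.e. sets w′_{p−1} = w_{p−1} + B and leaves all other edge weights unchanged, has error exactly (n−2)·B; if p = 1 (e* has no left neighbour), the redistribution that leaves all edge weights unchanged has error exactly (n−2)·B. Hence the lower bound |ΔE| ≥ (n−2)·B is tight. -/
/-- The error of a pair of vertices when the left neighbour of the merged edge `p`, if there is one,
is marked: only pairs having `p` as an endpoint and the other endpoint outside the merged edge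
contribute. -/
lemma pairError_mark_left {p u v : ℕ} (hp : 1 ≤ p) (hu : 1 ≤ u) {w : ℕ → ℝ} (hw : 0 ≤ w p) :
    (if u < v ∧ (u ∉ (({p} : Finset ℕ) ∪ ({p} : Finset ℕ).image (· + 1)) ∨
        v ∉ (({p} : Finset ℕ) ∪ ({p} : Finset ℕ).image (· + 1))) then
      |(∑ i ∈ (Finset.Ico u v).filter (· ∈ ({p} : Finset ℕ)), w i) -
        ∑ i ∈ (Finset.Ico u v).filter (· ∉ ({p} : Finset ℕ)),
          (if 2 ≤ p ∧ i = p - 1 then w p else 0)|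
    else 0) =
      (if u = p then (if p + 1 < v then w p else 0) else 0) +
        (if v = p then (if u < p then w p else 0) else 0) := by
  have h₁ : (∑ i ∈ (Finset.Ico u v).filter (· ∈ ({p} : Finset ℕ)), w i) =
      if u ≤ p ∧ p < v then w p else 0 := by
    simp [Finset.sum_filter, Finset.sum_ite_eq', Finset.mem_Ico]
  have h₂ : (∑ i ∈ (Finset.Ico u v).filter (· ∉ ({p} : Finset ℕ)),
      (if 2 ≤ p ∧ i = p - 1 then w p else 0)) = if u < p ∧ p ≤ v then w p else 0 := by
    have h (i : ℕ) : (if i ∉ ({p} : Finset ℕ) then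
        (if 2 ≤ p ∧ i = p - 1 then w p else 0) else 0) =
        if i = p - 1 then (if 2 ≤ p then w p else 0) else 0 := by
      simp only [Finset.mem_singleton]
      split_ifs <;> first | rfl | omega
    rw [Finset.sum_filter, Finset.sum_congr rfl fun i _ => h i, Finset.sum_ite_eq']
    simp only [Finset.mem_Ico]
    split_ifs <;> first | rfl | omega
  rw [h₁, h₂]
  simp only [Finset.image_singleton, Finset.mem_union, Finset.mem_singleton]
  split_ifs <;> first | omega | simp [abs_of_nonneg hw]


/-- Merging the single edge `e_p` (`1 ≤ p ≤ n−1`) of weight `B = w p` in a weighted path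
`P_n` with `n ≥ 3`: if `p ≥ 2`, marking the left neighbouring edge (setting
`ε_{p−1} = w p` and all other `ε_i = 0`) gives error exactly `(n−2)·B`; if `p = 1`
(no left neighbour), leaving all weights unchanged gives error exactly `(n−2)·B`.
Hence the lower bound `(n−2)·B` is tight. -/
theorem pathError_single_edge_tight (n p : ℕ) (hn : 3 ≤ n)
    (hp1 : 1 ≤ p) (hp2 : p ≤ n - 1)
    (w : ℕ → ℝ) (hw : ∀ i, 0 ≤ w i) :
    pathError n w {p} (fun i => if 2 ≤ p ∧ i = p - 1 then w p else 0)
      = ((n : ℝ) - 2) * w p := by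
  rw [pathError, Finset.sum_congr rfl fun u hu => Finset.sum_congr rfl fun v _ =>
    pairError_mark_left hp1 (Finset.mem_Icc.mp hu).1 (hw p)]
  have hp : p ∈ Finset.Icc 1 n := Finset.mem_Icc.mpr ⟨hp1, by omega⟩
  have hright : (Finset.Icc 1 n).filter (p + 1 < ·) = Finset.Icc (p + 2) n := by
    ext; simp only [Finset.mem_filter, Finset.mem_Icc]; omega
  have hleft : (Finset.Icc 1 n).filter (· < p) = Finset.Ico 1 p := by
    ext; simp only [Finset.mem_filter, Finset.mem_Icc, Finset.mem_Ico]; omega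
  simp only [Finset.sum_add_distrib]
  rw [Finset.sum_comm]
  simp only [Finset.sum_ite_eq', hp, if_true]
  rw [← Finset.sum_filter, ← Finset.sum_filter, hright, hleft, Finset.sum_const,
    Finset.sum_const, Nat.card_Icc, Nat.card_Ico, ← add_nsmul,
    show n + 1 - (p + 2) + (p - 1) = n - 2 by omega, nsmul_eq_mul, Nat.cast_sub (by omega),
    Nat.cast_ofNat]
end

section
/- Let e* = e_p be a single merged edge of weight w* in a weighted path P_n that has both a left and a right neighbouring edge (2 ≤ p ≤ n−2). Then for every weight redistribution ε, the redistribution ε′ that alters only the left neighbouring edge of e* by setting ε′_{p−1} = w* and ε′_i = 0 for all i ≠ p−1 satisfies |ΔE|(ε′) ≤ |ΔE|(ε); that is, any weight redistribution can be transformed into one in which only the left neighbouring edge of e* is altered, without worsening the error. -/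
/-- The contribution of the ordered pair `(u, v)` to the error when the single edge `e_p`
is merged. -/
noncomputable def pairError (w : ℕ → ℝ) (p : ℕ) (ε : ℕ → ℝ) (u v : ℕ) : ℝ :=
  if u < v ∧ ((u ≠ p ∧ u ≠ p + 1) ∨ (v ≠ p ∧ v ≠ p + 1)) then
    |(if u ≤ p ∧ p < v then w p else 0) - ∑ i ∈ (Finset.Ico u v).filter (· ≠ p), ε i|
  else 0

lemma pathError_singleton (n : ℕ) (w : ℕ → ℝ) (p : ℕ) (ε : ℕ → ℝ) :
    pathError n w {p} ε =
      ∑ u ∈ Finset.Icc 1 n, ∑ v ∈ Finset.Icc 1 n, pairError w p ε u v := by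
  unfold pathError pairError
  refine Finset.sum_congr rfl fun u _ => Finset.sum_congr rfl fun v _ => ?_
  simp [Finset.sum_filter]

lemma pairError_nonneg (w : ℕ → ℝ) (p : ℕ) (ε : ℕ → ℝ) (u v : ℕ) :
    0 ≤ pairError w p ε u v := by
  unfold pairError
  split_ifs <;> positivity

lemma pairError_of_mem (w : ℕ → ℝ) (p : ℕ) (ε : ℕ → ℝ) {u v : ℕ}
    (hu : u = p ∨ u = p + 1) (hv : v = p ∨ v = p + 1) : pairError w p ε u v = 0 :=
  if_neg (by omega)

lemma pairError_of_le (w : ℕ → ℝ) (p : ℕ) (ε : ℕ → ℝ) {u v : ℕ} (h : v ≤ u) :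
    pairError w p ε u v = 0 :=
  if_neg (by omega)

lemma pairError_left_merged (w : ℕ → ℝ) (p : ℕ) (ε : ℕ → ℝ) {u : ℕ} (h : u < p) :
    pairError w p ε u p = |∑ i ∈ Finset.Ico u p, ε i| := by
  have hf : (Finset.Ico u p).filter (· ≠ p) = Finset.Ico u p := by
    ext i; simp only [Finset.mem_filter, Finset.mem_Ico]; omega
  rw [pairError, if_pos (by omega), if_neg (by omega), hf, zero_sub, abs_neg]

lemma pairError_left_merged_succ (w : ℕ → ℝ) (p : ℕ) (ε : ℕ → ℝ) {u : ℕ} (h : u < p) :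
    pairError w p ε u (p + 1) = |w p - ∑ i ∈ Finset.Ico u p, ε i| := by
  have hf : (Finset.Ico u (p + 1)).filter (· ≠ p) = Finset.Ico u p := by
    ext i; simp only [Finset.mem_filter, Finset.mem_Ico]; omega
  rw [pairError, if_pos (by omega), if_pos (by omega), hf]

lemma pairError_merged_right (w : ℕ → ℝ) (p : ℕ) (ε : ℕ → ℝ) {v : ℕ} (h : p + 1 < v) :
    pairError w p ε p v = |w p - ∑ i ∈ Finset.Ico (p + 1) v, ε i| := by
  have hf : (Finset.Ico p v).filter (· ≠ p) = Finset.Ico (p + 1) v := by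
    ext i; simp only [Finset.mem_filter, Finset.mem_Ico]; omega
  rw [pairError, if_pos (by omega), if_pos (by omega), hf]

lemma pairError_merged_succ_right (w : ℕ → ℝ) (p : ℕ) (ε : ℕ → ℝ) {v : ℕ} (h : p + 1 < v) :
    pairError w p ε (p + 1) v = |∑ i ∈ Finset.Ico (p + 1) v, ε i| := by
  have hf : (Finset.Ico (p + 1) v).filter (· ≠ p) = Finset.Ico (p + 1) v := by
    ext i; simp only [Finset.mem_filter, Finset.mem_Ico]; omega
  rw [pairError, if_pos (by omega), if_neg (by omega), hf, zero_sub, abs_neg]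

/-- Altering only the left neighbouring edge preserves all distances between vertices that are
not endpoints of the merged edge. -/
lemma pairError_alter_left_of_notMem (w : ℕ → ℝ) (p : ℕ) (hp : 1 ≤ p) {u v : ℕ}
    (hu : u ≠ p ∧ u ≠ p + 1) (hv : v ≠ p ∧ v ≠ p + 1) :
    pairError w p (fun i => if i = p - 1 then w p else 0) u v = 0 := by
  unfold pairError
  split_ifs with h h'
  · have hm : p - 1 ∈ (Finset.Ico u v).filter (· ≠ p) := by
      simp only [Finset.mem_filter, Finset.mem_Ico]; omega
    rw [Finset.sum_ite_eq', if_pos hm, sub_self, abs_zero]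
  · have hm : p - 1 ∉ (Finset.Ico u v).filter (· ≠ p) := by
      simp only [Finset.mem_filter, Finset.mem_Ico]; omega
    rw [Finset.sum_ite_eq', if_neg hm, sub_self, abs_zero]
  · rfl

/-- The part of a double sum supported on two given rows and two given columns. -/
lemma sum_cross {s : Finset ℕ} {p q : ℕ} (hp : p ∈ s) (hq : q ∈ s) (F : ℕ → ℕ → ℝ) :
    ∑ u ∈ s, ∑ v ∈ s, ((if v = p then F u p else 0) + (if v = q then F u q else 0) +
      ((if u = p then F p v else 0) + (if u = q then F q v else 0))) =
    ∑ u ∈ s, (F u p + F u q) + ∑ v ∈ s, (F p v + F q v) := by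
  simp only [Finset.sum_add_distrib]
  rw [Finset.sum_comm (f := fun u v => if u = p then F p v else 0),
    Finset.sum_comm (f := fun u v => if u = q then F q v else 0)]
  simp [hp, hq]

/-- Merging a single edge `e_p` of weight `w* = w p` that has both a left and a right
neighbouring edge (`2 ≤ p ≤ n−2`): for every weight redistribution `ε`, the
redistribution that alters only the left neighbouring edge (`ε′_{p−1} = w p`,
`ε′_i = 0` otherwise) has error no worse than that of `ε`. -/
theorem pathError_alter_only_left_neighbour (n p : ℕ) (hp1 : 2 ≤ p) (hp2 : p ≤ n - 2)
    (w : ℕ → ℝ) (hw : ∀ i, 0 ≤ w i) (ε : ℕ → ℝ)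
    (hε : ∀ i, 1 ≤ i → i ≤ n - 1 → i ≠ p → 0 ≤ w i + ε i) :
    pathError n w {p} (fun i => if i = p - 1 then w p else 0) ≤ pathError n w {p} ε := by
  rw [pathError_singleton, pathError_singleton]
  have hp : p ∈ Finset.Icc 1 n := by simp only [Finset.mem_Icc]; omega
  have hq : p + 1 ∈ Finset.Icc 1 n := by simp only [Finset.mem_Icc]; omega
  have hpw := hw p
  set δ : ℕ → ℝ := fun i => if i = p - 1 then w p else 0 with hδ
  have triangle (x : ℝ) : w p ≤ |x| + |w p - x| := by
    linarith [le_abs_self x, le_abs_self (w p - x)]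
  calc
    _ ≤ ∑ u ∈ Finset.Icc 1 n, (pairError w p δ u p + pairError w p δ u (p + 1)) +
        ∑ v ∈ Finset.Icc 1 n, (pairError w p δ p v + pairError w p δ (p + 1) v) := by
      rw [← sum_cross hp hq]
      refine Finset.sum_le_sum fun u _ => Finset.sum_le_sum fun v _ => ?_
      have h1 := pairError_nonneg w p δ u p
      have h2 := pairError_nonneg w p δ u (p + 1)
      have h3 := pairError_nonneg w p δ p v
      have h4 := pairError_nonneg w p δ (p + 1) v
      by_cases hu : u ≠ p ∧ u ≠ p + 1
      · by_cases hv : v ≠ p ∧ v ≠ p + 1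
        · rw [pairError_alter_left_of_notMem w p (by omega) hu hv]
          split_ifs <;> linarith
        · obtain rfl | rfl : v = p ∨ v = p + 1 := by omega
          all_goals split_ifs <;> first | omega | linarith
      · obtain rfl | rfl : u = p ∨ u = p + 1 := by omega
        all_goals split_ifs <;> first | omega | linarith
    _ ≤ ∑ u ∈ Finset.Icc 1 n, (pairError w p ε u p + pairError w p ε u (p + 1)) +
        ∑ v ∈ Finset.Icc 1 n, (pairError w p ε p v + pairError w p ε (p + 1) v) := by
      refine add_le_add (Finset.sum_le_sum fun u _ => ?_) (Finset.sum_le_sum fun v _ => ?_)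
      · rcases lt_or_ge u p with h | h
        · have hm : p - 1 ∈ Finset.Ico u p := by simp only [Finset.mem_Ico]; omega
          have hs : ∑ i ∈ Finset.Ico u p, δ i = w p := by
            rw [hδ, Finset.sum_ite_eq', if_pos hm]
          simp only [pairError_left_merged _ _ _ h, pairError_left_merged_succ _ _ _ h]
          rw [hs, sub_self, abs_zero, abs_of_nonneg hpw, add_zero]
          exact triangle _
        · have hz (η : ℕ → ℝ) : pairError w p η u p + pairError w p η u (p + 1) = 0 := by
            rw [pairError_of_le _ _ _ h, zero_add]
            rcases h.eq_or_lt with rfl | h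
            · exact pairError_of_mem _ _ _ (.inl rfl) (.inr rfl)
            · exact pairError_of_le _ _ _ h
          rw [hz, hz]
      · rcases lt_or_ge (p + 1) v with h | h
        · have hm : p - 1 ∉ Finset.Ico (p + 1) v := by simp only [Finset.mem_Ico]; omega
          have hs : ∑ i ∈ Finset.Ico (p + 1) v, δ i = 0 := by
            rw [hδ, Finset.sum_ite_eq', if_neg hm]
          simp only [pairError_merged_right _ _ _ h, pairError_merged_succ_right _ _ _ h]
          rw [hs, sub_zero, abs_zero, abs_of_nonneg hpw, add_zero, add_comm]
          exact triangle _
        · have hz (η : ℕ → ℝ) : pairError w p η p v + pairError w p η (p + 1) v = 0 := by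
            rw [pairError_of_le _ _ _ h, add_zero]
            rcases h.eq_or_lt with rfl | h
            · exact pairError_of_mem _ _ _ (.inl rfl) (.inr rfl)
            · exact pairError_of_le _ _ _ (by omega)
          rw [hz, hz]
    _ ≤ _ := by
      rw [← sum_cross hp hq]
      refine Finset.sum_le_sum fun u _ => Finset.sum_le_sum fun v _ => ?_
      have h0 := pairError_nonneg w p ε u v
      by_cases hu : u = p ∨ u = p + 1
      · by_cases hv : v = p ∨ v = p + 1
        · have hz {a b : ℕ} := @pairError_of_mem w p ε a b
          simp [hz hu (.inl rfl), hz hu (.inr rfl), hz (.inl rfl) hv, hz (.inr rfl) hv, h0]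
        · obtain rfl | rfl := hu
          all_goals split_ifs <;> first | omega | linarith
      · by_cases hv : v = p ∨ v = p + 1
        · obtain rfl | rfl := hv
          all_goals split_ifs <;> first | omega | linarith
        · split_ifs <;> first | omega | linarith
end

section
/- For all real numbers x and y, ΔE(x,y) ≥ B·k′·(n_L + n_R), and equality holds for x = A and y = B + C. (Interpretation: the error incurred by merging an edge of weight B joining two supernodes of cardinalities k ≥ k′ in a weighted path on n vertices is at least B·k′·(n − (k + k′)), and this bound is achieved by marking the neighbouring edge adjacent to the smaller supernode.) -/
/-- Merging an edge of weight `B` joining two supernodes of cardinalities `k ≥ k′ ≥ 1`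
in a weighted path, with `n_L` (resp. `n_R`) vertices in the subpath beyond the left
(resp. right) neighbouring edge of weights `A` (resp. `C`), so `n_L + n_R = n − (k + k′)`:
for all new neighbouring weights `x, y`, the error
`ΔE(x,y) = (k−k′)·n_L·|x−A| + n_L·k′·(|x−A| + |x−A−B|) + (k−k′)·n_R·|y−B−C|`
`  + n_R·k′·(|y−C| + |y−B−C|) + n_L·n_R·|x+y−A−B−C|`
satisfies `ΔE(x,y) ≥ B·k′·(n_L + n_R)`, with equality at `x = A`, `y = B + C`
(marking the edge adjacent to the smaller supernode). -/
theorem supernode_merge_error (nL nR : ℕ) (k k' : ℕ) (hk' : 1 ≤ k') (hkk' : k' ≤ k)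
    (A B C : ℝ) (hA : 0 ≤ A) (hB : 0 ≤ B) (hC : 0 ≤ C) :
    (∀ x y : ℝ,
        B * k' * (nL + nR) ≤
          ((k : ℝ) - k') * nL * |x - A| + nL * k' * (|x - A| + |x - A - B|)
            + ((k : ℝ) - k') * nR * |y - B - C| + nR * k' * (|y - C| + |y - B - C|)
            + nL * nR * |x + y - A - B - C|) ∧
    ((k : ℝ) - k') * nL * |A - A| + nL * k' * (|A - A| + |A - A - B|)
        + ((k : ℝ) - k') * nR * |(B + C) - B - C| + nR * k' * (|(B + C) - C| + |(B + C) - B - C|)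
        + nL * nR * |A + (B + C) - A - B - C|
      = B * k' * (nL + nR) := by
  have hk : (0 : ℝ) ≤ (k : ℝ) - k' := sub_nonneg.2 (Nat.cast_le.2 hkk')
  refine ⟨fun x y => ?_, ?_⟩
  · have hx : B ≤ |x - A| + |x - A - B| := by
      linarith [le_abs_self (x - A), neg_le_abs (x - A - B)]
    have hy : B ≤ |y - C| + |y - B - C| := by
      linarith [le_abs_self (y - C), neg_le_abs (y - B - C)]
    have hL : (nL : ℝ) * k' * B ≤ nL * k' * (|x - A| + |x - A - B|) := by gcongr
    have hR : (nR : ℝ) * k' * B ≤ nR * k' * (|y - C| + |y - B - C|) := by gcongr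
    have hL' : 0 ≤ ((k : ℝ) - k') * nL * |x - A| := by positivity
    have hR' : 0 ≤ ((k : ℝ) - k') * nR * |y - B - C| := by positivity
    have hLR : 0 ≤ (nL : ℝ) * nR * |x + y - A - B - C| := by positivity
    linarith
  · have h : A + (B + C) - A - B - C = 0 := by ring
    have h' : B + C - B - C = 0 := by ring
    simp only [h, h', sub_self, zero_sub, add_sub_cancel_right, abs_zero, abs_neg, abs_of_nonneg hB]
    ring
end

section
/- If k is even, then the total error E(x,y) = E_L(x) + E_R(y) + n_L·n_R·|x + y − (w_0 + w_1 + ⋯ + w_{k+1})| attains its minimum over all (x,y) ∈ ℝ² at x* = w_0 + w_1 + ⋯ + w_{k/2} and y* = w_{k/2+1} + w_{k/2+2} + ⋯ + w_{k+1}; that is, E(x*,y*) ≤ E(x,y) for all real x, y. (Interpretation: the optimal way to contract a contiguous subpath with k edges is to assign the sum of the weights of the left half of its edges, together with the old weight, to the left neighbouring edge, and the right half to the right neighbouring edge.) -/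
/-- Error between the `n_L` vertices on the left of a contracted contiguous subpath `P′`
(with edge weights `w 1, …, w k`, left neighbouring edge of weight `w 0`) and the `k+1`
vertices of `P′`, when the new weight of the left neighbouring edge is `x`:
`E_L(x) = n_L · Σ_{m=0}^{k} |x − (w_0 + w_1 + ⋯ + w_m)|`. -/
noncomputable def EL (k : ℕ) (w : ℕ → ℝ) (nL : ℕ) (x : ℝ) : ℝ :=
  nL * ∑ m ∈ Finset.range (k + 1), |x - ∑ j ∈ Finset.range (m + 1), w j|

/-- Error between the `n_R` vertices on the right of the contracted subpath `P′`
(right neighbouring edge of weight `w (k+1)`) and the vertices of `P′`, when the new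
weight of the right neighbouring edge is `y`:
`E_R(y) = n_R · Σ_{m=1}^{k+1} |y − (w_m + w_{m+1} + ⋯ + w_{k+1})|`. -/
noncomputable def ER (k : ℕ) (w : ℕ → ℝ) (nR : ℕ) (y : ℝ) : ℝ :=
  nR * ∑ m ∈ Finset.Icc 1 (k + 1), |y - ∑ j ∈ Finset.Icc m (k + 1), w j|

/-- The middle term of a monotone sequence of odd length minimizes the sum of distances. -/
theorem Monotone.sum_abs_sub_median_le {f : ℕ → ℝ} (hf : Monotone f) (h : ℕ) (x : ℝ) :
    ∑ i ∈ Finset.range (2 * h + 1), |f h - f i| ≤ ∑ i ∈ Finset.range (2 * h + 1), |x - f i| := by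
  have reflect (z : ℝ) : ∑ i ∈ Finset.range (2 * h + 1), |z - f (2 * h - i)| =
      ∑ i ∈ Finset.range (2 * h + 1), |z - f i| := by
    simpa using Finset.sum_range_reflect (fun i => |z - f i|) (2 * h + 1)
  have pair : ∑ i ∈ Finset.range (2 * h + 1), (|f h - f i| + |f h - f (2 * h - i)|) ≤
      ∑ i ∈ Finset.range (2 * h + 1), (|x - f i| + |x - f (2 * h - i)|) := by
    refine Finset.sum_le_sum fun i _ => ?_
    rcases le_total i h with hi | hi
    · have h₁ := hf hi
      have h₂ := hf (show h ≤ 2 * h - i by lia)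
      rw [abs_of_nonneg (sub_nonneg.2 h₁), abs_of_nonpos (sub_nonpos.2 h₂)]
      linarith [le_abs_self (x - f i), neg_le_abs (x - f (2 * h - i))]
    · have h₁ := hf hi
      have h₂ := hf (show 2 * h - i ≤ h by lia)
      rw [abs_of_nonpos (sub_nonpos.2 h₁), abs_of_nonneg (sub_nonneg.2 h₂)]
      linarith [neg_le_abs (x - f i), le_abs_self (x - f (2 * h - i))]
  rw [Finset.sum_add_distrib, Finset.sum_add_distrib, reflect, reflect] at pair
  linarith

/-- The middle term of an antitone sequence of odd length minimizes the sum of distances. -/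
theorem Antitone.sum_abs_sub_median_le {f : ℕ → ℝ} (hf : Antitone f) (h : ℕ) (x : ℝ) :
    ∑ i ∈ Finset.range (2 * h + 1), |f h - f i| ≤ ∑ i ∈ Finset.range (2 * h + 1), |x - f i| := by
  have key := hf.neg.sum_abs_sub_median_le h (-x)
  simpa only [Pi.neg_apply, ← neg_sub', abs_neg] using key

/-- If `k` is even, the total error
`E(x,y) = E_L(x) + E_R(y) + n_L·n_R·|x + y − (w_0 + ⋯ + w_{k+1})|`
of contracting a contiguous subpath with `k` edges attains its minimum over `ℝ²` at
`x* = w_0 + ⋯ + w_{k/2}` and `y* = w_{k/2+1} + ⋯ + w_{k+1}`: the optimal contraction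
assigns the weight of the left half of the subpath to the left neighbouring edge and
the right half to the right neighbouring edge. -/
theorem subpath_contraction_optimal (k : ℕ) (hk : Even k) (w : ℕ → ℝ)
    (hw : ∀ j, 0 ≤ w j) (nL nR : ℕ) (x y : ℝ) :
    EL k w nL (∑ j ∈ Finset.range (k / 2 + 1), w j)
        + ER k w nR (∑ j ∈ Finset.Icc (k / 2 + 1) (k + 1), w j)
        + nL * nR * |(∑ j ∈ Finset.range (k / 2 + 1), w j)
            + (∑ j ∈ Finset.Icc (k / 2 + 1) (k + 1), w j)
            - ∑ j ∈ Finset.range (k + 2), w j|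
      ≤ EL k w nL x + ER k w nR y
          + nL * nR * |x + y - ∑ j ∈ Finset.range (k + 2), w j| := by
  obtain ⟨h, rfl⟩ := hk.two_dvd
  rw [Nat.mul_div_cancel_left h two_pos]
  have hS : Monotone fun m => ∑ j ∈ Finset.range (m + 1), w j := fun a b hab =>
    Finset.sum_le_sum_of_subset_of_nonneg (Finset.range_mono (by lia)) fun j _ _ => hw j
  have hT : Antitone fun m => ∑ j ∈ Finset.Icc (m + 1) (2 * h + 1), w j := fun a b hab =>
    Finset.sum_le_sum_of_subset_of_nonneg (Finset.Icc_subset_Icc_left (by lia)) fun j _ _ => hw j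
  have hL : EL (2 * h) w nL (∑ j ∈ Finset.range (h + 1), w j) ≤ EL (2 * h) w nL x :=
    mul_le_mul_of_nonneg_left (hS.sum_abs_sub_median_le h x) nL.cast_nonneg
  have shift (g : ℕ → ℝ) : ∑ m ∈ Finset.Icc 1 (2 * h + 1), g m =
      ∑ m ∈ Finset.range (2 * h + 1), g (m + 1) := by
    rw [← Finset.Ico_add_one_right_eq_Icc, Finset.sum_Ico_eq_sum_range]
    simp [add_comm]
  have hR : ER (2 * h) w nR (∑ j ∈ Finset.Icc (h + 1) (2 * h + 1), w j) ≤
      ER (2 * h) w nR y := by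
    unfold ER
    rw [shift, shift]
    exact mul_le_mul_of_nonneg_left (hT.sum_abs_sub_median_le h y) nR.cast_nonneg
  have total : (∑ j ∈ Finset.range (h + 1), w j) + ∑ j ∈ Finset.Icc (h + 1) (2 * h + 1), w j =
      ∑ j ∈ Finset.range (2 * h + 2), w j := by
    rw [← Finset.Ico_add_one_right_eq_Icc]
    exact Finset.sum_range_add_sum_Ico w (by lia)
  rw [total, sub_self, abs_zero, mul_zero, add_zero]
  have : 0 ≤ (nL * nR : ℝ) * |x + y - ∑ j ∈ Finset.range (2 * h + 2), w j| := by positivity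
  linarith
end

section
/- Let E_m = {e_i : i ∈ M} be a set of merged edges of the weighted path P_n, where M ⊆ {1,…,n−1} contains no two consecutive indices (so the merged edges are pairwise independent and induce a matching). Then for every weight redistribution ε, the redistribution ε′ defined by ε′_{i−1} = w_i for each i ∈ M with i ≥ 2 and ε′_j = 0 for every other non-merged edge e_j satisfies |ΔE|(ε′) ≤ |ΔE|(ε). Hence there exists an optimal redistribution that marks exactly the left neighbouring edge of each merged edge (omitting the leftmost merged edge if it has no left neighbour) and leaves all other edges unchanged. -/
/-- The potential of the vertex `v`: the signed error accumulated along the path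
from the first vertex to `v`. -/
noncomputable def pathPotential (w : ℕ → ℝ) (M : Finset ℕ) (ε : ℕ → ℝ) (v : ℕ) : ℝ :=
  ∑ i ∈ Finset.Ico 1 v, if i ∈ M then w i else -ε i

lemma pathPotential_succ (w : ℕ → ℝ) (M : Finset ℕ) (ε : ℕ → ℝ) {v : ℕ} (hv : 1 ≤ v) :
    pathPotential w M ε (v + 1) =
      pathPotential w M ε v + if v ∈ M then w v else -ε v :=
  Finset.sum_Ico_succ_top hv _

lemma sum_merged_sub_sum_eq_pathPotential_sub (w : ℕ → ℝ) (M : Finset ℕ) (ε : ℕ → ℝ)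
    {u v : ℕ} (hu : 1 ≤ u) (huv : u ≤ v) :
    (∑ i ∈ (Finset.Ico u v).filter (· ∈ M), w i) -
        ∑ i ∈ (Finset.Ico u v).filter (· ∉ M), ε i =
      pathPotential w M ε v - pathPotential w M ε u := by
  unfold pathPotential
  rw [← Finset.sum_Ico_consecutive _ hu huv, Finset.sum_ite, Finset.sum_ite,
    Finset.sum_neg_distrib, Finset.sum_neg_distrib]
  ring

lemma two_mul_sum_lt_eq_sum (s : Finset ℕ) (f : ℕ → ℕ → ℝ) (hsymm : ∀ u v, f u v = f v u)
    (hdiag : ∀ u, f u u = 0) :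
    2 * ∑ u ∈ s, ∑ v ∈ s, (if u < v then f u v else 0) = ∑ u ∈ s, ∑ v ∈ s, f u v := by
  rw [two_mul]
  nth_rewrite 2 [Finset.sum_comm]
  simp only [← Finset.sum_add_distrib]
  refine Finset.sum_congr rfl fun u _ => Finset.sum_congr rfl fun v _ => ?_
  rcases lt_trichotomy u v with h | h | h
  · simp [h, h.not_gt]
  · subst h
    simp [hdiag]
  · simp [h, h.not_gt, hsymm u v]

lemma sum_matched_vertices (M : Finset ℕ) (hind : ∀ i ∈ M, i + 1 ∉ M) (f : ℕ → ℝ) :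
    ∑ v ∈ M ∪ M.image (· + 1), f v = ∑ i ∈ M, (f i + f (i + 1)) := by
  rw [Finset.sum_union, Finset.sum_image, Finset.sum_add_distrib]
  · intro a _ b _ h
    simpa using h
  · rw [Finset.disjoint_right]
    intro a ha
    obtain ⟨i, hi, rfl⟩ := Finset.mem_image.mp ha
    exact hind i hi

/-- Twice the error, split into the pairs of unmatched vertices and the pairs formed by an
unmatched vertex and an endpoint of a merged edge. -/
lemma two_mul_pathError (n : ℕ) (w : ℕ → ℝ) (M : Finset ℕ)
    (hM : M ⊆ Finset.Icc 1 (n - 1)) (hind : ∀ i ∈ M, i + 1 ∉ M) (ε : ℕ → ℝ) :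
    2 * pathError n w M ε =
      (∑ u ∈ Finset.Icc 1 n \ (M ∪ M.image (· + 1)),
        ∑ v ∈ Finset.Icc 1 n \ (M ∪ M.image (· + 1)),
          |pathPotential w M ε v - pathPotential w M ε u|) +
      2 * ∑ u ∈ Finset.Icc 1 n \ (M ∪ M.image (· + 1)), ∑ i ∈ M,
        (|pathPotential w M ε i - pathPotential w M ε u| +
          |pathPotential w M ε (i + 1) - pathPotential w M ε u|) := by
  have hV : M ∪ M.image (· + 1) ⊆ Finset.Icc 1 n := by
    intro a ha
    rcases Finset.mem_union.mp ha with h | h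
    · have := Finset.mem_Icc.mp (hM h)
      exact Finset.mem_Icc.mpr (by omega)
    · obtain ⟨i, hi, rfl⟩ := Finset.mem_image.mp h
      have := Finset.mem_Icc.mp (hM hi)
      exact Finset.mem_Icc.mpr (by omega)
  simp only [← sum_matched_vertices M hind
    fun v => |pathPotential w M ε v - pathPotential w M ε _|]
  set V := M ∪ M.image (· + 1)
  set x := pathPotential w M ε
  let f : ℕ → ℕ → ℝ := fun u v => if u ∉ V ∨ v ∉ V then |x v - x u| else 0
  have hf : ∀ u v, f u v = f v u := fun u v => by
    simp only [f, abs_sub_comm (x v), or_comm]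
  have herr : pathError n w M ε =
      ∑ u ∈ Finset.Icc 1 n, ∑ v ∈ Finset.Icc 1 n, if u < v then f u v else 0 := by
    unfold pathError
    refine Finset.sum_congr rfl fun u hu => Finset.sum_congr rfl fun v _ => ?_
    rw [ite_and]
    by_cases h : u < v
    · rw [if_pos h, if_pos h,
        sum_merged_sub_sum_eq_pathPotential_sub w M ε (Finset.mem_Icc.mp hu).1 h.le]
    · rw [if_neg h, if_neg h]
  rw [herr, two_mul_sum_lt_eq_sum _ f hf fun u => by simp [f]]
  simp only [← Finset.sum_sdiff hV, Finset.sum_add_distrib]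
  have hVV : ∑ u ∈ V, ∑ v ∈ V, f u v = 0 :=
    Finset.sum_eq_zero fun u hu => Finset.sum_eq_zero fun v hv => by simp [f, hu, hv]
  have hVS : ∑ u ∈ V, ∑ v ∈ Finset.Icc 1 n \ V, f u v =
      ∑ u ∈ Finset.Icc 1 n \ V, ∑ v ∈ V, f u v := by
    rw [Finset.sum_comm]
    simp only [hf]
  have hS : ∀ t : Finset ℕ, ∑ u ∈ Finset.Icc 1 n \ V, ∑ v ∈ t, f u v =
      ∑ u ∈ Finset.Icc 1 n \ V, ∑ v ∈ t, |x v - x u| := fun t =>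
    Finset.sum_congr rfl fun u hu => Finset.sum_congr rfl fun v _ =>
      if_pos (Or.inl (Finset.mem_sdiff.mp hu).2)
  rw [hVV, hVS, hS, hS]
  ring

lemma pathPotential_mark_left (w : ℕ → ℝ) (M : Finset ℕ) (hind : ∀ i ∈ M, i + 1 ∉ M)
    {v : ℕ} (hv : 1 ≤ v) :
    pathPotential w M (fun j => if 1 ≤ j ∧ j + 1 ∈ M then w (j + 1) else 0) v =
      (if 1 ∈ M then w 1 else 0) - if v ∈ M then w v else 0 := by
  induction v, hv using Nat.le_induction with
  | base => simp [pathPotential]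
  | succ v hv ih =>
    rw [pathPotential_succ _ _ _ hv, ih]
    by_cases h : v ∈ M
    · simp [h, hind v h]
    · simp [h, hv, sub_eq_add_neg]

/-- For merging a set of pairwise independent edges `E_m = {e_i : i ∈ M}` (no two
consecutive indices, so `E_m` induces a matching) in a weighted path `P_n`: for every
weight redistribution `ε`, the redistribution that marks exactly the left neighbouring
edge of each merged edge (setting `ε′_{i−1} = w i` for each `i ∈ M` with `i ≥ 2`, and
`ε′_j = 0` for every other edge) has error no worse than that of `ε`. -/
theorem pathError_independent_edges_mark_left (n : ℕ) (M : Finset ℕ)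
    (hM : M ⊆ Finset.Icc 1 (n - 1)) (hind : ∀ i ∈ M, i + 1 ∉ M)
    (w : ℕ → ℝ) (hw : ∀ i, 0 ≤ w i) (ε : ℕ → ℝ)
    (hε : ∀ i, 1 ≤ i → i ≤ n - 1 → i ∉ M → 0 ≤ w i + ε i) :
    pathError n w M (fun j => if 1 ≤ j ∧ j + 1 ∈ M then w (j + 1) else 0)
      ≤ pathError n w M ε := by
  have hpos : ∀ i ∈ M, 1 ≤ i := fun i hi => (Finset.mem_Icc.mp (hM hi)).1
  have hpot := fun v (hv : 1 ≤ v) => pathPotential_mark_left w M hind hv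
  have hmem : ∀ u ∈ Finset.Icc 1 n \ (M ∪ M.image (· + 1)), 1 ≤ u ∧ u ∉ M := by
    intro u hu
    simp only [Finset.mem_sdiff, Finset.mem_Icc, Finset.mem_union, not_or] at hu
    exact ⟨hu.1.1, hu.2.1⟩
  refine le_of_mul_le_mul_left ?_ (two_pos : (0 : ℝ) < 2)
  rw [two_mul_pathError n w M hM hind, two_mul_pathError n w M hM hind]
  refine add_le_add
    (Finset.sum_le_sum fun u hu => Finset.sum_le_sum fun v hv => ?_)
    (mul_le_mul_of_nonneg_left
      (Finset.sum_le_sum fun u hu => Finset.sum_le_sum fun i hi => ?_) zero_le_two)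
  · rw [hpot u (hmem u hu).1, hpot v (hmem v hv).1, if_neg (hmem u hu).2,
      if_neg (hmem v hv).2, sub_self, abs_zero]
    exact abs_nonneg _
  · rw [hpot u (hmem u hu).1, hpot i (hpos i hi), hpot (i + 1) (by omega),
      if_neg (hmem u hu).2, if_neg (hind i hi), if_pos hi, sub_self, abs_zero, add_zero,
      sub_zero, sub_sub_cancel_left, abs_neg, abs_of_nonneg (hw i),
      pathPotential_succ w M ε (hpos i hi), if_pos hi]
    have h₁ := neg_abs_le (pathPotential w M ε i - pathPotential w M ε u)
    have h₂ := le_abs_self (pathPotential w M ε i + w i - pathPotential w M ε u)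
    have h₃ := le_abs_self (pathPotential w M ε i - pathPotential w M ε u)
    linarith
end

section
/- Let E_m = {e_i : i ∈ M} be a set of k ≥ 1 merged edges of the weighted path P_n, where M ⊆ {1,…,n−1}, |M| = k, and M contains no two consecutive indices (the merged edges are pairwise independent). Then the minimum of |ΔE| over all weight redistributions equals (n − 2k) · Σ_{i∈M} w_i: every redistribution has |ΔE| ≥ (n − 2k) · Σ_{i∈M} w_i, and the redistribution that, for each i ∈ M with i ≥ 2, sets ε_{i−1} = w_i and leaves every other non-merged edge unchanged attains this value. -/
/-- If `F` is a potential whose increments are `w` on `M` and `-ε` off `M`, then the signed error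
between two vertices is the difference of the potentials. -/
theorem sum_filter_sub_sum_filter_eq_sub {M : Finset ℕ} {w ε F : ℕ → ℝ}
    (hF : ∀ i, 1 ≤ i → F (i + 1) - F i = if i ∈ M then w i else -ε i) {u v : ℕ}
    (hu : 1 ≤ u) (huv : u ≤ v) :
    (∑ i ∈ (Finset.Ico u v).filter (· ∈ M), w i) -
      ∑ i ∈ (Finset.Ico u v).filter (· ∉ M), ε i = F v - F u := by
  induction v, huv using Nat.le_induction with
  | base => simp
  | succ v huv ih =>
    have h := hF v (hu.trans huv)
    simp only [Finset.sum_filter] at ih ⊢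
    rw [Finset.sum_Ico_succ_top huv, Finset.sum_Ico_succ_top huv]
    by_cases hv : v ∈ M <;> simp only [hv, if_true, if_false, not_true, not_false_eq_true] at h ⊢ <;>
      linarith

/-- A symmetric sum over pairs meeting the complement of `S` splits into the pairs between the
complement and `S` and the pairs inside the complement. -/
theorem sum_pairs_meeting_compl_eq {A S : Finset ℕ} (hS : S ⊆ A) (g : ℕ → ℕ → ℝ)
    (hg : ∀ u v, g u v = g v u) :
    (∑ u ∈ A, ∑ v ∈ A, if u < v ∧ (u ∉ S ∨ v ∉ S) then g u v else 0) =
      (∑ u ∈ A \ S, ∑ v ∈ S, g u v) +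
        ∑ u ∈ A \ S, ∑ v ∈ A \ S, if u < v then g u v else 0 := by
  have hsplit : ∀ f : ℕ → ℝ, ∑ u ∈ A, f u = ∑ u ∈ A \ S, f u + ∑ u ∈ S, f u :=
    fun f => (Finset.sum_sdiff hS).symm
  have hcross : (∑ u ∈ A \ S, ∑ v ∈ S, g u v) =
      (∑ u ∈ A \ S, ∑ v ∈ S, if u < v then g u v else 0) +
        ∑ u ∈ S, ∑ v ∈ A \ S, if u < v then g u v else 0 := by
    rw [Finset.sum_comm (s := S), ← Finset.sum_add_distrib]
    refine Finset.sum_congr rfl fun u hu => ?_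
    rw [← Finset.sum_add_distrib]
    refine Finset.sum_congr rfl fun v hv => ?_
    have hne : u ≠ v := by
      rintro rfl
      exact (Finset.mem_sdiff.mp hu).2 hv
    rcases lt_or_gt_of_ne hne with h | h
    · simp [h, h.not_gt]
    · simp [h, h.not_gt, hg u v]
  have houter : (∑ u ∈ A \ S, ∑ v ∈ A, if u < v ∧ (u ∉ S ∨ v ∉ S) then g u v else 0) =
      (∑ u ∈ A \ S, ∑ v ∈ A \ S, if u < v then g u v else 0) +
        ∑ u ∈ A \ S, ∑ v ∈ S, if u < v then g u v else 0 := by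
    rw [← Finset.sum_add_distrib]
    refine Finset.sum_congr rfl fun u hu => ?_
    simp [(Finset.mem_sdiff.mp hu).2, hsplit]
  have hinner : (∑ u ∈ S, ∑ v ∈ A, if u < v ∧ (u ∉ S ∨ v ∉ S) then g u v else 0) =
      ∑ u ∈ S, ∑ v ∈ A \ S, if u < v then g u v else 0 := by
    refine Finset.sum_congr rfl fun u hu => ?_
    rw [hsplit]
    have hzero : (∑ v ∈ S, if u < v ∧ (u ∉ S ∨ v ∉ S) then g u v else 0) = 0 :=
      Finset.sum_eq_zero fun v hv => by simp [hu, hv]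
    rw [hzero, add_zero]
    refine Finset.sum_congr rfl fun v hv => ?_
    simp [(Finset.mem_sdiff.mp hv).2]
  rw [hsplit, houter, hinner, hcross]
  ring

/-- The endpoints of independent edges contribute in pairs. -/
theorem sum_union_image_succ {M : Finset ℕ} (hind : ∀ i ∈ M, i + 1 ∉ M) {R : Type*}
    [AddCommMonoid R] (f : ℕ → R) :
    ∑ y ∈ M ∪ M.image (· + 1), f y = ∑ i ∈ M, (f i + f (i + 1)) := by
  have hdisj : Disjoint M (M.image (· + 1)) := by
    rw [Finset.disjoint_right]
    intro a ha
    obtain ⟨i, hi, rfl⟩ := Finset.mem_image.mp ha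
    exact hind i hi
  rw [Finset.sum_union hdisj, Finset.sum_image (by intro a _ b _ h; simpa using h),
    Finset.sum_add_distrib]

theorem union_image_succ_subset_Icc {n : ℕ} {M : Finset ℕ} (hM : M ⊆ Finset.Icc 1 (n - 1)) :
    M ∪ M.image (· + 1) ⊆ Finset.Icc 1 n := by
  intro a ha
  rcases Finset.mem_union.mp ha with h | h
  · have := Finset.mem_Icc.mp (hM h)
    exact Finset.mem_Icc.mpr (by omega)
  · obtain ⟨i, hi, rfl⟩ := Finset.mem_image.mp h
    have := Finset.mem_Icc.mp (hM hi)
    exact Finset.mem_Icc.mpr (by omega)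

theorem card_Icc_sdiff_union_image_succ {n : ℕ} {M : Finset ℕ}
    (hM : M ⊆ Finset.Icc 1 (n - 1)) (hind : ∀ i ∈ M, i + 1 ∉ M) :
    ((Finset.Icc 1 n \ (M ∪ M.image (· + 1))).card : ℝ) = n - 2 * M.card := by
  have hS : (M ∪ M.image (· + 1)).card = 2 * M.card := by
    rw [Finset.card_eq_sum_ones, sum_union_image_succ hind]
    simp [mul_comm]
  rw [Finset.cast_card_sdiff (union_image_succ_subset_Icc hM), hS]
  simp

/-- The error in terms of a potential, split into the pairs between an unmerged vertex and a merged
edge and the pairs of unmerged vertices. -/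
theorem pathError_eq_of_potential {n : ℕ} {M : Finset ℕ} (hM : M ⊆ Finset.Icc 1 (n - 1))
    (hind : ∀ i ∈ M, i + 1 ∉ M) {w ε F : ℕ → ℝ}
    (hF : ∀ i, 1 ≤ i → F (i + 1) - F i = if i ∈ M then w i else -ε i) :
    pathError n w M ε =
      (∑ u ∈ Finset.Icc 1 n \ (M ∪ M.image (· + 1)),
        ∑ i ∈ M, (|F i - F u| + |F (i + 1) - F u|)) +
      ∑ u ∈ Finset.Icc 1 n \ (M ∪ M.image (· + 1)),
        ∑ v ∈ Finset.Icc 1 n \ (M ∪ M.image (· + 1)), if u < v then |F v - F u| else 0 := by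
  simp only [← sum_union_image_succ hind (fun y => |F y - F _|)]
  rw [← sum_pairs_meeting_compl_eq (union_image_succ_subset_Icc hM) (fun u v => |F v - F u|)
    (fun u v => abs_sub_comm _ _), pathError]
  refine Finset.sum_congr rfl fun u hu => Finset.sum_congr rfl fun v _ => ?_
  split_ifs with h
  · rw [sum_filter_sub_sum_filter_eq_sub hF (Finset.mem_Icc.mp hu).1 h.1.le]
  · rfl

/-- For merging a set of `k ≥ 1` pairwise independent edges `E_m = {e_i : i ∈ M}`
(no two consecutive indices) in a weighted path `P_n`, the minimum error over all
weight redistributions equals `(n − 2k) · Σ_{i∈M} w i`: every redistribution has error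
at least this value, and the redistribution marking the left neighbour of each merged
edge (omitting a merged leftmost edge `e_1`) attains it. -/
theorem pathError_independent_edges_optimal (n k : ℕ) (hk : 1 ≤ k) (M : Finset ℕ)
    (hM : M ⊆ Finset.Icc 1 (n - 1)) (hcard : M.card = k)
    (hind : ∀ i ∈ M, i + 1 ∉ M)
    (w : ℕ → ℝ) (hw : ∀ i, 0 ≤ w i) :
    (∀ ε : ℕ → ℝ, (∀ i, 1 ≤ i → i ≤ n - 1 → i ∉ M → 0 ≤ w i + ε i) →
        ((n : ℝ) - 2 * k) * (∑ i ∈ M, w i) ≤ pathError n w M ε) ∧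
    pathError n w M (fun j => if 1 ≤ j ∧ j + 1 ∈ M then w (j + 1) else 0)
      = ((n : ℝ) - 2 * k) * ∑ i ∈ M, w i := by
  subst hcard
  have hcard := card_Icc_sdiff_union_image_succ hM hind
  refine ⟨fun ε _ => ?_, ?_⟩
  · have hF : ∀ i, 1 ≤ i →
        (∑ j ∈ Finset.Ico 1 (i + 1), if j ∈ M then w j else -ε j) -
          (∑ j ∈ Finset.Ico 1 i, if j ∈ M then w j else -ε j) =
            if i ∈ M then w i else -ε i := fun i hi => by
      rw [Finset.sum_Ico_succ_top hi, add_sub_cancel_left]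
    set F : ℕ → ℝ := fun v => ∑ j ∈ Finset.Ico 1 v, if j ∈ M then w j else -ε j
    rw [pathError_eq_of_potential (F := F) hM hind hF, ← hcard, ← nsmul_eq_mul,
      ← Finset.sum_const]
    refine le_add_of_le_of_nonneg
      (Finset.sum_le_sum fun u _ => Finset.sum_le_sum fun i hi => ?_)
      (Finset.sum_nonneg fun u _ => Finset.sum_nonneg fun v _ => by positivity)
    have h : F (i + 1) - F i = w i := by
      simpa [hi] using hF i (Finset.mem_Icc.mp (hM hi)).1
    have h₁ := neg_abs_le (F i - F u)
    have h₂ := le_abs_self (F (i + 1) - F u)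
    linarith
  · rw [pathError_eq_of_potential (F := fun v => if v ∈ M then -w v else 0) hM hind]
    · have hzero : ∀ u ∈ Finset.Icc 1 n \ (M ∪ M.image (· + 1)), u ∉ M := fun u hu h =>
        (Finset.mem_sdiff.mp hu).2 (Finset.mem_union_left _ h)
      rw [← hcard, ← nsmul_eq_mul, ← Finset.sum_const]
      refine (congrArg₂ (· + ·) (Finset.sum_congr rfl fun u hu => Finset.sum_congr rfl
        fun i hi => ?_) (Finset.sum_eq_zero fun u hu => Finset.sum_eq_zero
        fun v hv => ?_)).trans (add_zero _)
      · simp [hi, hind i hi, hzero u hu, abs_of_nonneg (hw i)]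
      · simp [hzero u hu, hzero v hv]
    · intro i hi
      by_cases h : i ∈ M
      · simp [h, hind i h]
      · by_cases h' : i + 1 ∈ M <;> simp [h, h', hi]
end

section
/- Suppose all subtrees on the left have the same size n_L ≥ 1 (L_i = n_L for all i) and all subtrees on the right have the same size n_R ≥ 1 (R_j = n_R for all j), and suppose the left side is preferable, i.e. n_L²·𝓛·(𝓛−1) ≤ n_R²·ℛ·(ℛ−1). Then the marking ({1,…,𝓛}, ∅) that fully marks the left side and leaves the right side unmarked minimizes E over all markings: E({1,…,𝓛}, ∅) ≤ E(A,B) for every marking (A,B). -/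
open Finset in
/-- For a contracted edge `e*` in a weighted tree with `l` left and `r` right neighbouring
edges, where the subtree hanging off the `i`-th left (resp. `j`-th right) neighbouring edge
has `L i` (resp. `R j`) vertices, and a marking `(A, B)` of left/right neighbouring edges,
the error (in units of `w*`) is
`E(A,B) = 2·Σ_{i<j ∈ A} L_i·L_j + 2·Σ_{i<j ∈ B} R_i·R_j + Σ_{i∈A, j∈B} L_i·R_j`
`  + Σ_{i∈A, i′∉A} L_i·L_{i′} + Σ_{j∈B, j′∉B} R_j·R_{j′} + Σ_{i∉A, j∉B} L_i·R_j`. -/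
def markErr {l r : ℕ} (L : Fin l → ℕ) (R : Fin r → ℕ)
    (A : Finset (Fin l)) (B : Finset (Fin r)) : ℕ :=
  2 * (∑ i ∈ A, ∑ j ∈ A, if i < j then L i * L j else 0)
    + 2 * (∑ i ∈ B, ∑ j ∈ B, if i < j then R i * R j else 0)
    + (∑ i ∈ A, ∑ j ∈ B, L i * R j)
    + (∑ i ∈ A, ∑ j ∈ Aᶜ, L i * L j)
    + (∑ i ∈ B, ∑ j ∈ Bᶜ, R i * R j)
    + (∑ i ∈ Aᶜ, ∑ j ∈ Bᶜ, L i * R j)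

open Finset in
theorem two_mul_sum_sum_lt_add {ι : Type*} [LinearOrder ι] (A : Finset ι) (c : ℕ) :
    2 * (∑ i ∈ A, ∑ j ∈ A, if i < j then c else 0) + #A * c = #A * #A * c := by
  have hswap : (∑ i ∈ A, ∑ j ∈ A, if i < j then c else 0)
      = ∑ i ∈ A, ∑ j ∈ A, if j < i then c else 0 := sum_comm
  have hdiag : #A * c = ∑ i ∈ A, ∑ j ∈ A, if i = j then c else 0 := by
    simp +contextual [sum_ite_eq]
  have hall : #A * #A * c = ∑ i ∈ A, ∑ j ∈ A, c := by simp [mul_assoc]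
  rw [two_mul, hall, hdiag]
  nth_rewrite 2 [hswap]
  simp only [← sum_add_distrib]
  refine sum_congr rfl fun i _ => sum_congr rfl fun j _ => ?_
  rcases lt_trichotomy i j with h | h | h
  · simp [h, h.not_gt, h.ne]
  · simp [h]
  · simp [h, h.not_gt, h.ne']

open Finset in
/-- With equal subtree sizes on each side, the error is bilinear in the numbers of marked edges. -/
theorem markErr_const {l r : ℕ} (m n : ℕ) (A : Finset (Fin l)) (B : Finset (Fin r)) :
    (markErr (fun _ => m) (fun _ => n) A B : ℤ)
      = m ^ 2 * #A * (l - 1) + n ^ 2 * #B * (r - 1)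
        + m * n * (#A * #B + (l - #A) * (r - #B)) := by
  have hA : (#Aᶜ : ℤ) = l - #A := by
    rw [card_compl, Fintype.card_fin, Nat.cast_sub (by simpa using card_le_univ A)]
  have hB : (#Bᶜ : ℤ) = r - #B := by
    rw [card_compl, Fintype.card_fin, Nat.cast_sub (by simpa using card_le_univ B)]
  have hpA := congrArg (Nat.cast : ℕ → ℤ) (two_mul_sum_sum_lt_add A (m * m))
  have hpB := congrArg (Nat.cast : ℕ → ℤ) (two_mul_sum_sum_lt_add B (n * n))
  rw [Nat.cast_add, ← eq_sub_iff_add_eq] at hpA hpB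
  unfold markErr
  simp only [Nat.cast_add, hpA, hpB, sum_const, smul_eq_mul, Nat.cast_mul, hA, hB]
  ring

/-- A bilinear function on a rectangle is bounded below by the smallest of its corner values;
here the corner `(l, 0)`. -/
theorem corner_le_of_preferable {l r m n a b : ℤ} (hl : 1 ≤ l) (hr : 1 ≤ r) (hm : 1 ≤ m)
    (hn : 1 ≤ n) (ha : 0 ≤ a) (hal : a ≤ l) (hb : 0 ≤ b) (hbr : b ≤ r)
    (hpref : m ^ 2 * l * (l - 1) ≤ n ^ 2 * r * (r - 1)) :
    m ^ 2 * l * (l - 1)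
      ≤ m ^ 2 * a * (l - 1) + n ^ 2 * b * (r - 1) + m * n * (a * b + (l - a) * (r - b)) := by
  have hunmarked : m * (l - 1) ≤ n * r := by
    by_contra! h
    nlinarith [mul_pos (by positivity : 0 < n) (by positivity : 0 < r),
      mul_pos (by positivity : 0 < n ^ 2) (by positivity : 0 < r)]
  have h00 : 0 ≤ m * l * (n * r - m * (l - 1)) :=
    mul_nonneg (by positivity) (sub_nonneg.2 hunmarked)
  have h01 : 0 ≤ n ^ 2 * r * (r - 1) - m ^ 2 * l * (l - 1) := sub_nonneg.2 hpref
  have h11 : 0 ≤ n ^ 2 * r * (r - 1) + m * n * l * r :=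
    add_nonneg (mul_nonneg (by positivity) (by linarith)) (by positivity)
  have hal' : 0 ≤ l - a := sub_nonneg.2 hal
  have hbr' : 0 ≤ r - b := sub_nonneg.2 hbr
  refine le_of_mul_le_mul_left ?_ (by positivity : 0 < l * r)
  linear_combination mul_nonneg (mul_nonneg hal' hbr') h00 + mul_nonneg (mul_nonneg hal' hb) h01
    + mul_nonneg (mul_nonneg ha hb) h11

/-- If all left subtrees have the same size `n_L ≥ 1`, all right subtrees have the same
size `n_R ≥ 1`, and the left side is preferable
(`n_L²·l·(l−1) ≤ n_R²·r·(r−1)`), then fully marking the left side and leaving the right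
side unmarked minimizes the error over all markings. -/
theorem equal_subtrees_full_left_marking_optimal (l r : ℕ) (hl : 1 ≤ l) (hr : 1 ≤ r)
    (nL nR : ℕ) (hnL : 1 ≤ nL) (hnR : 1 ≤ nR)
    (hpref : nL ^ 2 * l * (l - 1) ≤ nR ^ 2 * r * (r - 1)) :
    ∀ (A : Finset (Fin l)) (B : Finset (Fin r)),
      markErr (fun _ : Fin l => nL) (fun _ : Fin r => nR) Finset.univ ∅
        ≤ markErr (fun _ : Fin l => nL) (fun _ : Fin r => nR) A B := by
  intro A B
  have hprefZ : (nL : ℤ) ^ 2 * l * (l - 1) ≤ nR ^ 2 * r * (r - 1) := by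
    have h := hpref
    zify [hl, hr] at h
    exact h
  have hA : A.card ≤ l := by simpa using Finset.card_le_univ A
  have hB : B.card ≤ r := by simpa using Finset.card_le_univ B
  zify
  rw [markErr_const, markErr_const]
  have h := corner_le_of_preferable (a := A.card) (b := B.card) (by exact_mod_cast hl)
    (by exact_mod_cast hr) (by exact_mod_cast hnL) (by exact_mod_cast hnR) (by positivity)
    (by exact_mod_cast hA) (by positivity) (by exact_mod_cast hB) hprefZ
  simpa using h
end

section
/- No optimal marking has marked edges on both sides: for every marking (A,B) with A ≠ ∅ and B ≠ ∅, there exists a marking (A′,B′) with A′ = ∅ or B′ = ∅ such that E(A′,B′) < E(A,B). -/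
theorem two_mul_sum_lt_mul_add_sum_sq {ι R : Type*} [LinearOrder ι] [CommSemiring R] (s : Finset ι)
    (f : ι → R) :
    2 * (∑ i ∈ s, ∑ j ∈ s, if i < j then f i * f j else 0) + ∑ i ∈ s, f i ^ 2 =
      (∑ i ∈ s, f i) ^ 2 := by
  have hswap : (∑ i ∈ s, ∑ j ∈ s, if i < j then f i * f j else 0) =
      ∑ i ∈ s, ∑ j ∈ s, if j < i then f i * f j else 0 := by
    rw [Finset.sum_comm]
    simp only [mul_comm]
  have hdiag : ∑ i ∈ s, f i ^ 2 = ∑ i ∈ s, ∑ j ∈ s, if i = j then f i * f j else 0 := by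
    refine Finset.sum_congr rfl fun i hi => ?_
    rw [Finset.sum_ite_eq, if_pos hi, sq]
  rw [two_mul]
  nth_rw 2 [hswap]
  rw [hdiag, sq, Finset.sum_mul_sum]
  simp only [← Finset.sum_add_distrib]
  refine Finset.sum_congr rfl fun i _ => Finset.sum_congr rfl fun j _ => ?_
  rcases lt_trichotomy i j with h | h | h
  · simp [h, h.not_gt, h.ne]
  · simp [h]
  · simp [h, h.not_gt, h.ne']

/-- The error in terms of the marked sizes, their sums of squares, and the total sizes. -/
theorem markErr_eq {l r : ℕ} (L : Fin l → ℕ) (R : Fin r → ℕ)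
    (A : Finset (Fin l)) (B : Finset (Fin r)) :
    (markErr L R A B : ℤ) = (∑ i, (L i : ℤ)) * ∑ j, (R j : ℤ)
      + ((∑ i ∈ A, (L i : ℤ)) - ∑ j ∈ B, (R j : ℤ)) * ((∑ i, (L i : ℤ)) - ∑ j, (R j : ℤ))
      + 2 * (∑ i ∈ A, (L i : ℤ)) * (∑ j ∈ B, (R j : ℤ))
      - ∑ i ∈ A, (L i : ℤ) ^ 2 - ∑ j ∈ B, (R j : ℤ) ^ 2 := by
  have hA := two_mul_sum_lt_mul_add_sum_sq A fun i => (L i : ℤ)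
  have hB := two_mul_sum_lt_mul_add_sum_sq B fun j => (R j : ℤ)
  rw [← Finset.sum_add_sum_compl A fun i => (L i : ℤ),
    ← Finset.sum_add_sum_compl B fun j => (R j : ℤ)]
  unfold markErr
  push_cast
  simp only [← Finset.sum_mul_sum]
  linear_combination hA + hB

/-- No optimal marking has marked edges on both sides: every marking `(A, B)` with
`A ≠ ∅` and `B ≠ ∅` is strictly beaten by a marking with one side empty. -/
theorem no_optimal_marking_both_sides (l r : ℕ) (hl : 1 ≤ l) (hr : 1 ≤ r)
    (L : Fin l → ℕ) (R : Fin r → ℕ) (hL : ∀ i, 1 ≤ L i) (hR : ∀ j, 1 ≤ R j)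
    (A : Finset (Fin l)) (B : Finset (Fin r)) (hA : A ≠ ∅) (hB : B ≠ ∅) :
    ∃ (A' : Finset (Fin l)) (B' : Finset (Fin r)),
      (A' = ∅ ∨ B' = ∅) ∧ markErr L R A' B' < markErr L R A B := by
  have ha : 0 < ∑ i ∈ A, (L i : ℤ) :=
    Finset.sum_pos (fun i _ => by exact_mod_cast hL i) (Finset.nonempty_iff_ne_empty.mpr hA)
  have hb : 0 < ∑ j ∈ B, (R j : ℤ) :=
    Finset.sum_pos (fun j _ => by exact_mod_cast hR j) (Finset.nonempty_iff_ne_empty.mpr hB)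
  have hA2 : ∑ i ∈ A, (L i : ℤ) ^ 2 ≤ (∑ i ∈ A, (L i : ℤ)) ^ 2 :=
    Finset.sum_sq_le_sq_sum_of_nonneg fun i _ => Int.natCast_nonneg _
  have hB2 : ∑ j ∈ B, (R j : ℤ) ^ 2 ≤ (∑ j ∈ B, (R j : ℤ)) ^ 2 :=
    Finset.sum_sq_le_sq_sum_of_nonneg fun j _ => Int.natCast_nonneg _
  have hE := markErr_eq L R A B
  have hEA := markErr_eq L R A ∅
  have hEB := markErr_eq L R ∅ B
  simp only [Finset.sum_empty] at hEA hEB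
  set a := ∑ i ∈ A, (L i : ℤ)
  set b := ∑ j ∈ B, (R j : ℤ)
  set D := (∑ i, (L i : ℤ)) - ∑ j, (R j : ℤ)
  by_cases h : a < D + 2 * b
  · refine ⟨∅, B, Or.inl rfl, ?_⟩
    zify
    nlinarith [mul_pos ha (sub_pos.mpr h)]
  · refine ⟨A, ∅, Or.inr rfl, ?_⟩
    have h' : 0 < 2 * a - D - b := by linarith
    zify
    nlinarith [mul_pos hb h']
end

section
/- The optimal marking is a partial left or partial right marking: the minimum of E(A,B) over all markings (A,B) equals the minimum of ( min over A ⊆ {1,…,𝓛} of E(A,∅) ) and ( min over B ⊆ {1,…,ℛ} of E(∅,B) ). -/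
open Finset in
theorem two_mul_sum_lt_add_sum_sq {n : ℕ} (f : Fin n → ℕ) (s : Finset (Fin n)) :
    2 * (∑ i ∈ s, ∑ j ∈ s, if i < j then f i * f j else 0) + ∑ i ∈ s, f i ^ 2
      = (∑ i ∈ s, f i) ^ 2 := by
  have hdiag : ∑ i ∈ s, f i ^ 2 = ∑ i ∈ s, ∑ j ∈ s, if i = j then f i * f j else 0 := by
    refine sum_congr rfl fun i hi => ?_
    rw [sum_ite_eq, if_pos hi, sq]
  have hswap : (∑ i ∈ s, ∑ j ∈ s, if i < j then f i * f j else 0)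
      = ∑ i ∈ s, ∑ j ∈ s, if j < i then f i * f j else 0 := by
    rw [sum_comm]
    simp only [mul_comm]
  rw [two_mul, hdiag]
  nth_rewrite 2 [hswap]
  rw [sq, sum_mul_sum]
  simp only [← sum_add_distrib]
  refine sum_congr rfl fun i _ => sum_congr rfl fun j _ => ?_
  rcases lt_trichotomy i j with h | h | h
  · simp [h, h.not_gt, h.ne]
  · simp [h]
  · simp [h, h.not_gt, h.ne']

/-- The marking error in terms of the total weights, the marked weights and the marked sums of
squares. -/
theorem markErr_cast {l r : ℕ} (L : Fin l → ℕ) (R : Fin r → ℕ)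
    (A : Finset (Fin l)) (B : Finset (Fin r)) :
    (markErr L R A B : ℤ)
      = (∑ i, L i : ℕ) * (∑ j, R j : ℕ)
        + ((∑ i ∈ A, L i : ℕ) - (∑ j ∈ B, R j : ℕ)) * ((∑ i, L i : ℕ) - (∑ j, R j : ℕ))
        + 2 * (∑ i ∈ A, L i : ℕ) * (∑ j ∈ B, R j : ℕ)
        - (∑ i ∈ A, L i ^ 2 : ℕ) - (∑ j ∈ B, R j ^ 2 : ℕ) := by
  have hA := two_mul_sum_lt_add_sum_sq L A
  have hB := two_mul_sum_lt_add_sum_sq R B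
  unfold markErr
  simp only [← Finset.sum_mul_sum]
  rw [← Finset.sum_add_sum_compl A L, ← Finset.sum_add_sum_compl B R]
  zify at hA hB
  push_cast
  linear_combination hA + hB

theorem markErr_empty_le_or {l r : ℕ} (L : Fin l → ℕ) (R : Fin r → ℕ)
    (A : Finset (Fin l)) (B : Finset (Fin r)) :
    markErr L R A ∅ ≤ markErr L R A B ∨ markErr L R ∅ B ≤ markErr L R A B := by
  have hA : (∑ i ∈ A, L i ^ 2 : ℕ) ≤ (∑ i ∈ A, L i) ^ 2 :=
    two_mul_sum_lt_add_sum_sq L A ▸ Nat.le_add_left _ _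
  have hB : (∑ j ∈ B, R j ^ 2 : ℕ) ≤ (∑ j ∈ B, R j) ^ 2 :=
    two_mul_sum_lt_add_sum_sq R B ▸ Nat.le_add_left _ _
  by_contra! h
  obtain ⟨h₁, h₂⟩ := h
  rw [← Int.ofNat_lt, markErr_cast, markErr_cast] at h₁ h₂
  simp only [Finset.sum_empty, Nat.cast_zero] at h₁ h₂
  generalize (∑ i ∈ A, L i ^ 2) = p at *
  generalize (∑ j ∈ B, R j ^ 2) = q at *
  generalize (∑ i ∈ A, L i) = a at *
  generalize (∑ j ∈ B, R j) = b at *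
  generalize (∑ i, L i) = S at *
  generalize (∑ j, R j) = T at *
  zify at hA hB
  have ha : ((S : ℤ) - T) + 2 * b < a :=
    lt_of_mul_lt_mul_left (a := (a : ℤ)) (by linarith) (by positivity)
  have hb : ((T : ℤ) - S) + 2 * a < b :=
    lt_of_mul_lt_mul_left (a := (b : ℤ)) (by linarith) (by positivity)
  omega

/-- The optimal marking is a partial left or partial right marking: the minimum of
`E(A,B)` over all markings equals the minimum of the optimal partial left marking value
and the optimal partial right marking value. -/
theorem optimal_marking_is_partial (l r : ℕ) (hl : 1 ≤ l) (hr : 1 ≤ r)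
    (L : Fin l → ℕ) (R : Fin r → ℕ) (hL : ∀ i, 1 ≤ L i) (hR : ∀ j, 1 ≤ R j) :
    (Finset.univ.inf' Finset.univ_nonempty
        (fun P : Finset (Fin l) × Finset (Fin r) => markErr L R P.1 P.2))
      = min
          (Finset.univ.inf' Finset.univ_nonempty
            (fun A : Finset (Fin l) => markErr L R A ∅))
          (Finset.univ.inf' Finset.univ_nonempty
            (fun B : Finset (Fin r) => markErr L R ∅ B)) := by
  apply le_antisymm
  · refine le_min (Finset.le_inf' _ _ fun A _ => ?_) (Finset.le_inf' _ _ fun B _ => ?_)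
    · exact Finset.inf'_le (fun P : Finset (Fin l) × Finset (Fin r) => markErr L R P.1 P.2)
        (Finset.mem_univ (A, ∅))
    · exact Finset.inf'_le (fun P : Finset (Fin l) × Finset (Fin r) => markErr L R P.1 P.2)
        (Finset.mem_univ (∅, B))
  · refine Finset.le_inf' _ _ fun P _ => ?_
    rcases markErr_empty_le_or L R P.1 P.2 with h | h
    · exact (min_le_left _ _).trans ((Finset.inf'_le _ (Finset.mem_univ P.1)).trans h)
    · exact (min_le_right _ _).trans ((Finset.inf'_le _ (Finset.mem_univ P.2)).trans h)
end

section
/- For every fractional marking (c,d) ∈ [0,1]^𝓛 × [0,1]^ℛ there exists a 0/1-valued fractional marking (c′,d′) ∈ {0,1}^𝓛 × {0,1}^ℛ with E_f(c′,d′) ≤ E_f(c,d); consequently, the minimum of E_f over [0,1]^𝓛 × [0,1]^ℛ is attained at a 0/1-valued marking, and fractional marking cannot achieve a strictly smaller error than (integral) marking. -/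
/-- For a contracted edge `e*` in a weighted tree with `l` left and `r` right neighbouring
edges, where the subtree hanging off the `i`-th left (resp. `j`-th right) neighbouring edge
has `L i` (resp. `R j`) vertices, and a fractional marking `(c, d)` (the `i`-th left edge
has its weight increased by `c i · w*`, and similarly on the right), the error in units of
`w*` is
`E_f(c,d) = Σ_{i<i′} L_i·L_{i′}·(c_i + c_{i′}) + Σ_{j<j′} R_j·R_{j′}·(d_j + d_{j′})`
`  + Σ_{i,j} L_i·R_j·|1 − c_i − d_j|`. -/
noncomputable def fracErr {l r : ℕ} (L : Fin l → ℕ) (R : Fin r → ℕ)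
    (c : Fin l → ℝ) (d : Fin r → ℝ) : ℝ :=
  (∑ i, ∑ i', if i < i' then (L i : ℝ) * (L i' : ℝ) * (c i + c i') else 0)
    + (∑ j, ∑ j', if j < j' then (R j : ℝ) * (R j' : ℝ) * (d j + d j') else 0)
    + ∑ i, ∑ j, (L i : ℝ) * (R j : ℝ) * |1 - c i - d j|

open MeasureTheory in
/-- `f` is integrable and its integral is `a`. -/
def HasMean {Ω : Type*} [MeasurableSpace Ω] (μ : Measure Ω) (f : Ω → ℝ) (a : ℝ) : Prop :=
  Integrable f μ ∧ ∫ t, f t ∂μ = a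

namespace HasMean

open MeasureTheory

variable {Ω : Type*} [MeasurableSpace Ω] {μ : Measure Ω} {f g : Ω → ℝ} {a b : ℝ}

lemma add (hf : HasMean μ f a) (hg : HasMean μ g b) :
    HasMean μ (fun t => f t + g t) (a + b) :=
  ⟨hf.1.add hg.1, by rw [integral_add hf.1 hg.1, hf.2, hg.2]⟩

lemma sub (hf : HasMean μ f a) (hg : HasMean μ g b) :
    HasMean μ (fun t => f t - g t) (a - b) :=
  ⟨hf.1.sub hg.1, by rw [integral_sub hf.1 hg.1, hf.2, hg.2]⟩

lemma const_mul (k : ℝ) (hf : HasMean μ f a) : HasMean μ (fun t => k * f t) (k * a) :=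
  ⟨hf.1.const_mul k, by rw [integral_const_mul, hf.2]⟩

lemma const [IsProbabilityMeasure μ] (k : ℝ) : HasMean μ (fun _ => k) k :=
  ⟨integrable_const k, by simp⟩

lemma sum {ι : Type*} {s : Finset ι} {F : ι → Ω → ℝ} {A : ι → ℝ}
    (h : ∀ i, HasMean μ (F i) (A i)) :
    HasMean μ (fun t => ∑ i ∈ s, F i t) (∑ i ∈ s, A i) :=
  ⟨integrable_finsetSum s fun i _ => (h i).1, by
    rw [integral_finsetSum s fun i _ => (h i).1]
    exact Finset.sum_congr rfl fun i _ => (h i).2⟩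

lemma ite_zero [IsProbabilityMeasure μ] {p : Prop} [Decidable p] (hf : HasMean μ f a) :
    HasMean μ (fun t => if p then f t else 0) (if p then a else 0) := by
  split_ifs
  · exact hf
  · exact const 0

end HasMean

/-- The threshold rounding of `x` at level `t`. -/
noncomputable def threshold (x t : ℝ) : ℝ := if t < x then 1 else 0

lemma threshold_eq_zero_or_one (x t : ℝ) : threshold x t = 0 ∨ threshold x t = 1 := by
  unfold threshold
  split_ifs <;> simp

lemma threshold_mono (t : ℝ) : Monotone fun x => threshold x t := by
  intro x y hxy
  simp only [threshold]
  split_ifs <;> linarith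

section ThresholdMean

open MeasureTheory

lemma isProbabilityMeasure_restrict_Ico :
    IsProbabilityMeasure (volume.restrict (Set.Ico (0 : ℝ) 1)) :=
  ⟨by simp⟩

/-- Rounding at a uniformly random threshold is unbiased. -/
lemma hasMean_threshold {x : ℝ} (hx : x ∈ Set.Icc (0 : ℝ) 1) :
    HasMean (volume.restrict (Set.Ico (0 : ℝ) 1)) (threshold x) x := by
  have := isProbabilityMeasure_restrict_Ico
  have heq : threshold x = (Set.Iio x).indicator fun _ => 1 := by
    ext t
    simp [threshold, Set.indicator_apply]
  have hset : Set.Iio x ∩ Set.Ico (0 : ℝ) 1 = Set.Ico 0 x := by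
    ext t
    simp only [Set.mem_inter_iff, Set.mem_Iio, Set.mem_Ico]
    exact ⟨fun h => ⟨h.2.1, h.1⟩, fun h => ⟨h.2, h.1, h.2.trans_le hx.2⟩⟩
  rw [heq]
  refine ⟨(integrable_const 1).indicator measurableSet_Iio, ?_⟩
  rw [integral_indicator measurableSet_Iio, Measure.restrict_restrict measurableSet_Iio, hset]
  simp [hx.1]

/-- Rounding two numbers at a common random threshold preserves their expected distance. -/
lemma hasMean_abs_threshold_sub {x y : ℝ} (hx : x ∈ Set.Icc (0 : ℝ) 1)
    (hy : y ∈ Set.Icc (0 : ℝ) 1) :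
    HasMean (volume.restrict (Set.Ico (0 : ℝ) 1))
      (fun t => |threshold x t - threshold y t|) |x - y| := by
  rcases le_total x y with h | h
  · simp_rw [fun t => abs_of_nonpos (sub_nonpos.2 (threshold_mono t h)),
      abs_of_nonpos (sub_nonpos.2 h), neg_sub]
    exact (hasMean_threshold hy).sub (hasMean_threshold hx)
  · simp_rw [fun t => abs_of_nonneg (sub_nonneg.2 (threshold_mono t h)),
      abs_of_nonneg (sub_nonneg.2 h)]
    exact (hasMean_threshold hx).sub (hasMean_threshold hy)

/-- Rounding the left marking and the complement of the right marking at a common uniformly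
random threshold preserves the expected error. -/
lemma hasMean_fracErr_threshold {l r : ℕ} (L : Fin l → ℕ) (R : Fin r → ℕ)
    {c : Fin l → ℝ} {d : Fin r → ℝ}
    (hc : ∀ i, c i ∈ Set.Icc (0 : ℝ) 1) (hd : ∀ j, d j ∈ Set.Icc (0 : ℝ) 1) :
    HasMean (volume.restrict (Set.Ico (0 : ℝ) 1))
      (fun t => fracErr L R (fun i => threshold (c i) t) (fun j => 1 - threshold (1 - d j) t))
      (fracErr L R c d) := by
  have := isProbabilityMeasure_restrict_Ico
  have hd' : ∀ j, 1 - d j ∈ Set.Icc (0 : ℝ) 1 := fun j =>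
    ⟨by linarith [(hd j).2], by linarith [(hd j).1]⟩
  have hright : ∀ j, HasMean (volume.restrict (Set.Ico (0 : ℝ) 1))
      (fun t => 1 - threshold (1 - d j) t) (d j) := fun j => by
    simpa using (HasMean.const 1).sub (hasMean_threshold (hd' j))
  have hcross : ∀ i j, HasMean (volume.restrict (Set.Ico (0 : ℝ) 1))
      (fun t => |1 - threshold (c i) t - (1 - threshold (1 - d j) t)|)
      |1 - c i - d j| := fun i j => by
    rw [sub_right_comm]
    simpa only [sub_sub_sub_cancel_left] using hasMean_abs_threshold_sub (hd' j) (hc i)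
  unfold fracErr
  refine (HasMean.add ?_ ?_).add ?_
  · exact .sum fun i => .sum fun i' =>
      (((hasMean_threshold (hc i)).add (hasMean_threshold (hc i'))).const_mul _).ite_zero
  · exact .sum fun j => .sum fun j' => (((hright j).add (hright j')).const_mul _).ite_zero
  · exact .sum fun i => .sum fun j => (hcross i j).const_mul _

end ThresholdMean

/-- Every fractional marking `(c, d) ∈ [0,1]^l × [0,1]^r` is matched or beaten by a
`0/1`-valued marking: fractional marking cannot achieve a strictly smaller error than
(integral) marking. -/
theorem fractional_marking_not_better (l r : ℕ) (hl : 1 ≤ l) (hr : 1 ≤ r)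
    (L : Fin l → ℕ) (R : Fin r → ℕ) (hL : ∀ i, 1 ≤ L i) (hR : ∀ j, 1 ≤ R j)
    (c : Fin l → ℝ) (d : Fin r → ℝ)
    (hc : ∀ i, c i ∈ Set.Icc (0 : ℝ) 1) (hd : ∀ j, d j ∈ Set.Icc (0 : ℝ) 1) :
    ∃ (c' : Fin l → ℝ) (d' : Fin r → ℝ),
      (∀ i, c' i = 0 ∨ c' i = 1) ∧ (∀ j, d' j = 0 ∨ d' j = 1) ∧
      fracErr L R c' d' ≤ fracErr L R c d := by
  have := isProbabilityMeasure_restrict_Ico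
  obtain ⟨hint, hmean⟩ := hasMean_fracErr_threshold L R hc hd
  obtain ⟨t, ht⟩ := MeasureTheory.exists_le_integral hint
  refine ⟨_, _, fun i => threshold_eq_zero_or_one (c i) t, fun j => ?_, ht.trans_eq hmean⟩
  rcases threshold_eq_zero_or_one (1 - d j) t with h | h <;> simp [h]
end
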